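/- (Joints theorem in ℝ^n) There is a constant C depending only on n ≥ 2 such that for every finite collection L of lines in ℝ^n, the number of joints of L is at most C·|L|^(n/(n-1)). -/

import Mathlib

open MvPolynomial

/-- A line in ℝⁿ, given by a base point and a nonzero direction vector. -/
structure Line (n : ℕ) where
  p : Fin n → ℝ
  v : Fin n → ℝ
  hv : v ≠ 0

/-- The set of points of a line. -/
def Line.carrier {n : ℕ} (ℓ : Line n) : Set (Fin n → ℝ) :=
  {x | ∃ t : ℝ, x = ℓ.p + t • ℓ.v}

/-- `x` is a joint of the collection of lines `L`: it lies on `n` lines of `L`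
whose directions are linearly independent. -/
def IsJoint {n : ℕ} (L : Finset (Line n)) (x : Fin n → ℝ) : Prop :=
  ∃ f : Fin n → Line n, (∀ i, f i ∈ L) ∧ (∀ i, x ∈ (f i).carrier) ∧
    LinearIndependent ℝ (fun i => (f i).v)

/-- The set of joints of `L`. -/
def joints {n : ℕ} (L : Finset (Line n)) : Set (Fin n → ℝ) :=
  {x | IsJoint L x}

namespace JointsProof

/-- Restriction of a polynomial to a parametrised line. -/
noncomputable def restr {n : ℕ} (p v : Fin n → ℝ) : MvPolynomial (Fin n) ℝ →ₐ[ℝ] Polynomial ℝ :=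
  aeval (fun i => Polynomial.C (v i) * Polynomial.X + Polynomial.C (p i))

lemma eval_restr {n : ℕ} (p v : Fin n → ℝ) (P : MvPolynomial (Fin n) ℝ) (t : ℝ) :
    (restr p v P).eval t = eval (p + t • v) P := by
  induction P using MvPolynomial.induction_on with
  | C a => simp [restr]
  | add P Q hP hQ => simp [hP, hQ]
  | mul_X P i hP =>
    rw [map_mul, Polynomial.eval_mul, hP, map_mul]
    simp [restr]
    left; ring

lemma derivative_restr {n : ℕ} (p v : Fin n → ℝ) (P : MvPolynomial (Fin n) ℝ) :
    Polynomial.derivative (restr p v P)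
      = ∑ i, Polynomial.C (v i) * restr p v (pderiv i P) := by
  classical
  induction P using MvPolynomial.induction_on with
  | C a => simp [restr]
  | add P Q hP hQ => simp [hP, hQ, mul_add, Finset.sum_add_distrib]
  | mul_X P j hP =>
    rw [map_mul, Polynomial.derivative_mul, hP]
    have h1 : ∀ i, Polynomial.C (v i) * restr p v (pderiv i (P * X j))
        = Polynomial.C (v i) * restr p v (pderiv i P) * restr p v (X j)
          + (if i = j then Polynomial.C (v i) * restr p v P else 0) := by
      intro i
      rw [pderiv_mul, pderiv_X, map_add, map_mul, map_mul]
      by_cases h : i = j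
      · subst h; simp; ring
      · simp [h, Pi.single_apply, Ne.symm h]; ring
    rw [Finset.sum_congr rfl (fun i _ => h1 i), Finset.sum_add_distrib, ← Finset.sum_mul]
    simp [restr]
    ring

lemma natDegree_restr {n : ℕ} (p v : Fin n → ℝ) (P : MvPolynomial (Fin n) ℝ) :
    (restr p v P).natDegree ≤ P.totalDegree := by
  have := MvPolynomial.aeval_natDegree_le P le_rfl
    (fun i => Polynomial.C (v i) * Polynomial.X + Polynomial.C (p i)) (n := 1)
    (fun i => Polynomial.natDegree_linear_le)
  simpa [restr] using this

lemma totalDegree_pderiv {n : ℕ} (P : MvPolynomial (Fin n) ℝ) (i : Fin n) (h : pderiv i P ≠ 0) :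
    (pderiv i P).totalDegree < P.totalDegree := by
  obtain ⟨m, hm, he⟩ := Finset.exists_mem_eq_sup (pderiv i P).support
    (by simpa [Finset.nonempty_iff_ne_empty] using h) (fun s => s.sum fun _ e => e)
  have h2 : (pderiv i P).totalDegree = m.sum fun _ e => e := he
  have h3 : m + Finsupp.single i 1 ∈ P.support := by
    rw [mem_support_iff, coeff_pderiv] at hm
    rw [mem_support_iff]
    exact left_ne_zero_of_mul hm
  have h4 := le_totalDegree h3
  rw [Finsupp.sum_add_index' (by simp) (by simp)] at h4
  simp at h4
  omega

lemma eq_zero_of_pderiv {n : ℕ} (P : MvPolynomial (Fin n) ℝ) (h : ∀ i, pderiv i P = 0)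
    (x : Fin n → ℝ) (hx : eval x P = 0) : P = 0 := by
  apply MvPolynomial.funext
  intro y
  have hd : Polynomial.derivative (restr x (y - x) P) = 0 := by
    rw [derivative_restr]; simp [h]
  have hc := Polynomial.eq_C_of_derivative_eq_zero hd
  have e0 := eval_restr x (y - x) P 0
  have e1 := eval_restr x (y - x) P 1
  rw [hc] at e0 e1
  simp at e0 e1
  rw [← e1, e0, hx]; simp

lemma exists_poly {n : ℕ} (k : ℕ) (J : Finset (Fin n → ℝ)) (hJ : J.card < (k + 1) ^ n) :
    ∃ P : MvPolynomial (Fin n) ℝ, P ≠ 0 ∧ P.totalDegree ≤ n * k ∧ ∀ x ∈ J, eval x P = 0 := by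
  classical
  let ex : (Fin n → Fin (k + 1)) → (Fin n →₀ ℕ) :=
    fun e => Finsupp.equivFunOnFinite.symm (fun i => (e i : ℕ))
  have hex : Function.Injective ex := by
    intro a b hab
    have := Finsupp.equivFunOnFinite.symm.injective hab
    funext i
    exact Fin.ext (congrFun this i)
  let F : ((Fin n → Fin (k + 1)) → ℝ) →ₗ[ℝ] MvPolynomial (Fin n) ℝ :=
    { toFun := fun a => ∑ e, monomial (ex e) (a e)
      map_add' := fun a b => by simp [Finset.sum_add_distrib]
      map_smul' := fun c a => by simp [Finset.smul_sum, smul_monomial] }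
  let G : MvPolynomial (Fin n) ℝ →ₗ[ℝ] (J → ℝ) :=
    { toFun := fun P x => eval x.1 P
      map_add' := fun a b => by ext; simp
      map_smul' := fun c a => by ext; simp }
  have hker : LinearMap.ker (G ∘ₗ F) ≠ ⊥ := LinearMap.ker_ne_bot_of_finrank_lt (by simpa using hJ)
  obtain ⟨a, ha, ha0⟩ := (Submodule.ne_bot_iff _).mp hker
  refine ⟨F a, ?_, ?_, ?_⟩
  · intro h0
    apply ha0
    funext e
    have : coeff (ex e) (F a) = a e := by
      simp [F, coeff_sum, coeff_monomial, hex.eq_iff]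
    rw [← this, h0]; simp
  · refine (totalDegree_finsetSum _ _).trans (Finset.sup_le fun e _ => ?_)
    refine (totalDegree_monomial_le _ _).trans ?_
    rw [Finsupp.sum_fintype _ _ (by simp)]
    calc ∑ i, id (ex e i) ≤ ∑ i : Fin n, k := Finset.sum_le_sum fun i _ => by
            simp [ex]; omega
      _ = n * k := by simp
  · intro x hx
    exact congrFun (LinearMap.mem_ker.mp ha) ⟨x, hx⟩

open Classical in
lemma exists_line {n : ℕ} (k : ℕ) (L : Finset (Line n)) (J : Finset (Fin n → ℝ))
    (hJ : J.card < (k + 1) ^ n) (hne : J.Nonempty) (hj : ∀ x ∈ J, IsJoint L x) :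
    ∃ l ∈ L, (J.filter (· ∈ l.carrier)).card ≤ n * k := by
  by_contra! hcon
  have hex : ∃ d, ∃ P : MvPolynomial (Fin n) ℝ, P ≠ 0 ∧ P.totalDegree = d ∧
      ∀ x ∈ J, eval x P = 0 := by
    obtain ⟨P, h1, _, h3⟩ := exists_poly k J hJ
    exact ⟨_, P, h1, rfl, h3⟩
  obtain ⟨P, hP0, hPd, hPJ⟩ := Nat.find_spec hex
  have hmin : ∀ Q : MvPolynomial (Fin n) ℝ, Q.totalDegree < P.totalDegree →
      (∀ x ∈ J, eval x Q = 0) → Q = 0 := by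
    intro Q hQ hQJ
    by_contra h0
    exact Nat.find_min hex (hPd ▸ hQ) ⟨Q, h0, rfl, hQJ⟩
  have hdeg : P.totalDegree ≤ n * k := by
    obtain ⟨Q, h1, h2, h3⟩ := exists_poly k J hJ
    by_contra! hlt
    exact h1 (hmin Q (by omega) h3)
  have hline : ∀ l ∈ L, restr l.p l.v P = 0 := by
    intro l hl
    have hpar : ∀ x ∈ J.filter (· ∈ l.carrier), ∃ t : ℝ, x = l.p + t • l.v := by
      intro x hx; exact (Finset.mem_filter.mp hx).2
    choose! τ hτ using hpar
    by_contra h0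
    have hinj : Set.InjOn τ (J.filter (· ∈ l.carrier) : Finset _) := by
      intro x hx y hy hxy
      rw [hτ x hx, hτ y hy, hxy]
    have hsub : (J.filter (· ∈ l.carrier)).image τ ⊆ (restr l.p l.v P).roots.toFinset := by
      intro t ht
      obtain ⟨x, hx, rfl⟩ := Finset.mem_image.mp ht
      rw [Multiset.mem_toFinset, Polynomial.mem_roots h0, Polynomial.IsRoot.def, eval_restr,
        ← hτ x hx]
      exact hPJ x (Finset.mem_filter.mp hx).1
    have h1 := Finset.card_le_card hsub
    rw [Finset.card_image_of_injOn hinj] at h1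
    have h2 := Multiset.toFinset_card_le (restr l.p l.v P).roots
    have h3 := Polynomial.card_roots' (restr l.p l.v P)
    have h4 := natDegree_restr l.p l.v P
    have h5 := hcon l hl
    omega
  have hgrad : ∀ x ∈ J, ∀ i, eval x (pderiv i P) = 0 := by
    intro x hx
    obtain ⟨f, hfL, hfx, hli⟩ := hj x hx
    have hdot : ∀ j, ∑ i, (f j).v i * eval x (pderiv i P) = 0 := by
      intro j
      obtain ⟨t, ht⟩ := hfx j
      have h1 := derivative_restr (f j).p (f j).v P
      rw [hline _ (hfL j)] at h1
      have h2 := congrArg (Polynomial.eval t) h1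
      simp only [Polynomial.derivative_zero, Polynomial.eval_zero, Polynomial.eval_finset_sum,
        Polynomial.eval_mul, Polynomial.eval_C, eval_restr, ← ht] at h2
      exact h2.symm
    let A : Matrix (Fin n) (Fin n) ℝ := Matrix.of fun j => (f j).v
    have hA : IsUnit A := Matrix.linearIndependent_rows_iff_isUnit.mp hli
    have hm : A.mulVec (fun i => eval x (pderiv i P)) = 0 := by
      funext j; exact hdot j
    have := (Matrix.mulVec_injective_iff_isUnit.mpr hA) (hm.trans (Matrix.mulVec_zero A).symm)
    exact fun i => congrFun this i
  obtain ⟨x, hx⟩ := hne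
  refine hP0 (eq_zero_of_pderiv P (fun i => ?_) x (hPJ x hx))
  by_contra h0
  exact h0 (hmin _ (totalDegree_pderiv P i h0) fun y hy => hgrad y hy i)

open Classical in
lemma card_le {n : ℕ} (hn : 2 ≤ n) (k : ℕ) (m : ℕ) : ∀ (L : Finset (Line n)), L.card = m →
    ∀ (J : Finset (Fin n → ℝ)), J.card < (k + 1) ^ n → (∀ x ∈ J, IsJoint L x) →
    J.card ≤ n * k * m := by
  induction m with
  | zero =>
    intro L hL J _ hj
    rw [Finset.card_eq_zero] at hL
    subst hL
    rcases J.eq_empty_or_nonempty with h | ⟨x, hx⟩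
    · simp [h]
    · obtain ⟨f, hf, _⟩ := hj x hx
      exact absurd (hf ⟨0, by omega⟩) (by simp)
  | succ m ih =>
    intro L hL J hJ hj
    rcases J.eq_empty_or_nonempty with h | hne
    · simp [h]
    obtain ⟨l, hl, hc⟩ := exists_line k L J hJ hne hj
    have hsplit := Finset.card_filter_add_card_filter_not (s := J) (· ∈ l.carrier)
    have h1 := ih (L.erase l) (by rw [Finset.card_erase_of_mem hl]; omega)
      (J.filter (fun x => ¬ x ∈ l.carrier))
      (lt_of_le_of_lt (Finset.card_filter_le _ _) hJ) (by
        intro x hx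
        obtain ⟨hxJ, hxl⟩ := Finset.mem_filter.mp hx
        obtain ⟨f, hfL, hfx, hli⟩ := hj x hxJ
        refine ⟨f, fun i => Finset.mem_erase.mpr ⟨?_, hfL i⟩, hfx, hli⟩
        rintro rfl
        exact hxl (hfx i))
    rw [mul_add, mul_one]
    omega

end JointsProof

theorem stmt_9 (n : ℕ) (hn : 2 ≤ n) :
    ∃ C : ℝ, 0 < C ∧
      ∀ L : Finset (Line n),
        ((joints L).ncard : ℝ) ≤ C * (L.card : ℝ) ^ ((n : ℝ) / (n - 1)) := by
  have hn' : (2 : ℝ) ≤ n := by exact_mod_cast hn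
  refine ⟨(n : ℝ) ^ ((n : ℝ) / (n - 1)), by positivity, fun L => ?_⟩
  rw [← Real.mul_rpow (by positivity) (by positivity)]
  rcases (joints L).finite_or_infinite with hfin | hinf
  swap
  · rw [hinf.ncard]; simp; positivity
  rw [Set.ncard_eq_toFinset_card _ hfin]
  set N := hfin.toFinset.card with hN
  rcases Nat.eq_zero_or_pos N with h0 | hpos
  · rw [h0]; simp; positivity
  have hNpos : (0 : ℝ) < N := by exact_mod_cast hpos
  set r : ℝ := (N : ℝ) ^ (1 / (n : ℝ)) with hr
  have hrpos : 0 < r := by positivity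
  have hrn : r ^ n = N := by
    rw [hr, ← Real.rpow_natCast, ← Real.rpow_mul hNpos.le]
    rw [one_div_mul_cancel (by positivity), Real.rpow_one]
  have hlt : N < (⌊r⌋₊ + 1) ^ n := by
    have : (N : ℝ) < ((⌊r⌋₊ : ℝ) + 1) ^ n := by
      rw [← hrn]
      exact pow_lt_pow_left₀ (Nat.lt_floor_add_one r) hrpos.le (by omega)
    exact_mod_cast this
  have key := JointsProof.card_le hn ⌊r⌋₊ L.card L rfl hfin.toFinset hlt
    (fun x hx => by simpa [joints] using hx)
  have key2 : (N : ℝ) ≤ n * r * L.card := by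
    have h1 : (N : ℝ) ≤ n * (⌊r⌋₊ : ℝ) * L.card := by exact_mod_cast key
    refine h1.trans ?_
    gcongr
    exact Nat.floor_le hrpos.le
  have key3 : r ^ (n - 1) ≤ n * (L.card : ℝ) := by
    have : r ^ (n - 1) * r ≤ n * (L.card : ℝ) * r := by
      rw [← pow_succ, Nat.sub_add_cancel (by omega), hrn]; linarith
    exact le_of_mul_le_mul_right this hrpos
  have hne : ((n : ℝ) - 1) ≠ 0 := by linarith
  calc (N : ℝ) = (r ^ (n - 1)) ^ ((n : ℝ) / (n - 1)) := by
        rw [← Real.rpow_natCast r (n - 1), ← Real.rpow_mul hrpos.le, Nat.cast_sub (by omega),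
          Nat.cast_one, mul_div_cancel₀ _ hne, Real.rpow_natCast, hrn]
    _ ≤ _ := Real.rpow_le_rpow (by positivity) key3
        (div_nonneg (by positivity) (by linarith))
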